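/- The space V_ρ(λ;p) has the Kadec-Klee property (with weak convergence witnessed by coordinatewise convergence, since the coordinate functionals are continuous linear functionals): if x ∈ V_ρ(λ;p) with ‖x‖_L = 1, and (x_n) is a sequence in V_ρ(λ;p) with ‖x_n‖_L ≤ 1 for all n, ‖x_n‖_L → 1 as n → ∞, and x_n(j) → x(j) as n → ∞ for every coordinate j, then ‖x_n − x‖_L → 0 as n → ∞. -/

import Mathlib

open Filter
open scoped BigOperators ENNReal

/-- The index window `I_k = {j ∈ ℤ : k - λ_k + 1 ≤ j ≤ k}` of the
de la Vallée-Poussin mean (indices are positive integers). -/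
noncomputable def vpWindow (lam : ℕ → ℝ) (k : ℕ) : Finset ℕ :=
  (Finset.Icc 1 k).filter fun j => (k : ℝ) - lam k + 1 ≤ (j : ℝ)

/-- The modular `ρ(x) = ∑_{k≥1} ((1/λ_k) ∑_{j ∈ I_k} |x_j|)^{p_k}`,
valued in `ℝ≥0∞` (so that `ρ(x) < ∞` is meaningful). -/
noncomputable def vpModular (lam pp : ℕ → ℝ) (x : ℕ → ℝ) : ℝ≥0∞ :=
  ∑' k : ℕ, ENNReal.ofReal
    (((lam (k + 1))⁻¹ * ∑ j ∈ vpWindow lam (k + 1), |x j|) ^ pp (k + 1))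

/-- Membership in `V_ρ(λ;p) = {x : ρ(t x) < ∞ for some t > 0}`. -/
def memVrho (lam pp : ℕ → ℝ) (x : ℕ → ℝ) : Prop :=
  ∃ t : ℝ, 0 < t ∧ vpModular lam pp (t • x) < ⊤

/-- The Luxemburg norm `‖x‖_L = inf {t > 0 : ρ(x/t) ≤ 1}`. -/
noncomputable def luxNorm (lam pp : ℕ → ℝ) (x : ℕ → ℝ) : ℝ :=
  sInf {t : ℝ | 0 < t ∧ vpModular lam pp (t⁻¹ • x) ≤ 1}

lemma ENNReal.tsum_compl_eq_sub {u : ℕ → ℝ≥0∞} {S : Finset ℕ} (hS : ∑ k ∈ S, u k ≠ ⊤) :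
    ∑' k : ↥(S : Set ℕ)ᶜ, u k = ∑' k, u k - ∑ k ∈ S, u k := by
  rw [← ENNReal.sum_add_tsum_compl S u, ENNReal.add_sub_cancel_left hS]

/-- Generalized dominated convergence for series in `ℝ≥0∞`: if `h n` is dominated by
`C * (f n + g)` where `f n → g` termwise and in total mass, and `h n → 0` termwise, then the
sums of `h n` tend to zero. -/
lemma ENNReal.tendsto_tsum_zero_of_le_mul_add {f h : ℕ → ℕ → ℝ≥0∞} {g : ℕ → ℝ≥0∞} {C : ℝ≥0∞}
    (hC : C ≠ ⊤) (hg : ∑' k, g k ≠ ⊤)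
    (hle : ∀ n k, h n k ≤ C * (f n k + g k))
    (hf : ∀ k, Tendsto (fun n => f n k) atTop (nhds (g k)))
    (hh : ∀ k, Tendsto (fun n => h n k) atTop (nhds 0))
    (hsum : Tendsto (fun n => ∑' k, f n k) atTop (nhds (∑' k, g k))) :
    Tendsto (fun n => ∑' k, h n k) atTop (nhds 0) := by
  have hgS : ∀ S : Finset ℕ, ∑ k ∈ S, g k ≠ ⊤ := fun S =>
    ne_top_of_le_ne_top hg (ENNReal.sum_le_tsum S)
  have bound : ∀ S : Finset ℕ, ∀ᶠ n in atTop, ∑' k, h n k ≤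
      ∑ k ∈ S, h n k + C * ((∑' k, f n k - ∑ k ∈ S, f n k) + (∑' k, g k - ∑ k ∈ S, g k)) := by
    intro S
    have hfS : Tendsto (fun n => ∑ k ∈ S, f n k) atTop (nhds (∑ k ∈ S, g k)) :=
      tendsto_finsetSum S fun k _ => hf k
    filter_upwards [hfS.eventually_ne (hgS S)] with n hn
    calc ∑' k, h n k = ∑ k ∈ S, h n k + ∑' k : ↥(S : Set ℕ)ᶜ, h n k :=
          (ENNReal.sum_add_tsum_compl S (h n)).symm
      _ ≤ ∑ k ∈ S, h n k + ∑' k : ↥(S : Set ℕ)ᶜ, C * (f n k + g k) := by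
          gcongr with k
          exact hle n k
      _ = _ := by
          rw [ENNReal.tsum_mul_left, ENNReal.tsum_add, ENNReal.tsum_compl_eq_sub hn,
            ENNReal.tsum_compl_eq_sub (hgS S)]
  have lim : ∀ S : Finset ℕ, Tendsto (fun n => ∑ k ∈ S, h n k +
      C * ((∑' k, f n k - ∑ k ∈ S, f n k) + (∑' k, g k - ∑ k ∈ S, g k))) atTop
      (nhds (C * ((∑' k, g k - ∑ k ∈ S, g k) + (∑' k, g k - ∑ k ∈ S, g k)))) := by
    intro S
    have h1 : Tendsto (fun n => ∑ k ∈ S, h n k) atTop (nhds 0) := by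
      simpa using tendsto_finsetSum S fun k _ => hh k
    have h2 : Tendsto (fun n => ∑ k ∈ S, f n k) atTop (nhds (∑ k ∈ S, g k)) :=
      tendsto_finsetSum S fun k _ => hf k
    have h3 := ENNReal.Tendsto.sub hsum h2 (Or.inl hg)
    have h4 := h1.add (ENNReal.Tendsto.const_mul (h3.add_const (∑' k, g k - ∑ k ∈ S, g k))
      (Or.inr hC))
    simpa using h4
  have limS : Tendsto (fun S : Finset ℕ =>
      C * ((∑' k, g k - ∑ k ∈ S, g k) + (∑' k, g k - ∑ k ∈ S, g k))) atTop (nhds 0) := by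
    have h1 : Tendsto (fun S : Finset ℕ => ∑ k ∈ S, g k) atTop (nhds (∑' k, g k)) :=
      ENNReal.summable.hasSum
    have h2 := ENNReal.Tendsto.sub (tendsto_const_nhds (x := ∑' k, g k)) h1 (Or.inl hg)
    simpa using ENNReal.Tendsto.const_mul (h2.add h2) (Or.inr hC)
  refine tendsto_order.2 ⟨fun a ha => absurd ha not_lt_zero, fun ε hε => ?_⟩
  obtain ⟨S, hS⟩ := (limS.eventually_lt_const hε).exists
  filter_upwards [bound S, (lim S).eventually_lt_const hS] with n h1 h2
  exact h1.trans_lt h2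

lemma Real.add_rpow_le_two_rpow_mul_add {a b p H : ℝ} (ha : 0 ≤ a) (hb : 0 ≤ b) (hp : 0 ≤ p)
    (hpH : p ≤ H) : (a + b) ^ p ≤ 2 ^ H * (a ^ p + b ^ p) := by
  have hm : 0 ≤ max a b := le_max_of_le_left ha
  calc (a + b) ^ p ≤ (2 * max a b) ^ p := by
        gcongr
        linarith [le_max_left a b, le_max_right a b]
    _ = 2 ^ p * (max a b) ^ p := Real.mul_rpow (by norm_num) hm
    _ ≤ 2 ^ H * (a ^ p + b ^ p) := by
        have h1 : (0 : ℝ) ≤ a ^ p := Real.rpow_nonneg ha p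
        have h2 : (0 : ℝ) ≤ b ^ p := Real.rpow_nonneg hb p
        gcongr
        · norm_num
        · rcases max_cases a b with ⟨h, _⟩ | ⟨h, _⟩ <;> rw [h] <;> linarith

section Modular

variable {lam pp : ℕ → ℝ} {H : ℝ}

/-- The de la Vallée-Poussin mean `(1/λ_k) ∑_{j ∈ I_k} |x_j|`. -/
noncomputable def vpMean (lam : ℕ → ℝ) (x : ℕ → ℝ) (k : ℕ) : ℝ :=
  (lam k)⁻¹ * ∑ j ∈ vpWindow lam k, |x j|

lemma vpMean_nonneg (hlam : ∀ k : ℕ, 1 ≤ k → 0 < lam k) (x : ℕ → ℝ) (k : ℕ) :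
    0 ≤ vpMean lam x (k + 1) :=
  mul_nonneg (inv_nonneg.2 (hlam _ (Nat.le_add_left 1 k)).le)
    (Finset.sum_nonneg fun _ _ => abs_nonneg _)

lemma vpMean_smul (c : ℝ) (x : ℕ → ℝ) (k : ℕ) :
    vpMean lam (c • x) k = |c| * vpMean lam x k := by
  simp only [vpMean, Pi.smul_apply, smul_eq_mul, abs_mul, ← Finset.mul_sum]
  ring

lemma vpMean_sub_le (hlam : ∀ k : ℕ, 1 ≤ k → 0 < lam k) (x y : ℕ → ℝ) (k : ℕ) :
    vpMean lam (x - y) (k + 1) ≤ vpMean lam x (k + 1) + vpMean lam y (k + 1) := by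
  have := hlam _ (Nat.le_add_left 1 k)
  rw [vpMean, vpMean, vpMean, ← mul_add, ← Finset.sum_add_distrib]
  gcongr with j
  exact abs_sub _ _

lemma tendsto_vpMean {xs : ℕ → ℕ → ℝ} {x : ℕ → ℝ}
    (hcoord : ∀ j : ℕ, 1 ≤ j → Tendsto (fun n => xs n j) atTop (nhds (x j))) (k : ℕ) :
    Tendsto (fun n => vpMean lam (xs n) k) atTop (nhds (vpMean lam x k)) := by
  refine Tendsto.const_mul _ (tendsto_finsetSum _ fun j hj => (hcoord j ?_).abs)
  exact (Finset.mem_Icc.1 (Finset.mem_filter.1 hj).1).1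

lemma vpModular_eq (x : ℕ → ℝ) :
    vpModular lam pp x = ∑' k, ENNReal.ofReal (vpMean lam x (k + 1) ^ pp (k + 1)) := rfl

lemma vpModular_smul_le (hlam : ∀ k : ℕ, 1 ≤ k → 0 < lam k) (hp : ∀ k : ℕ, 1 ≤ k → 1 < pp k)
    (hH : ∀ k, pp (k + 1) ≤ H) {c d : ℝ} (hc : 0 ≤ c) (hcd : c ≤ d) (hd : 1 ≤ d) (x : ℕ → ℝ) :
    vpModular lam pp (c • x) ≤ ENNReal.ofReal (d ^ H) * vpModular lam pp x := by
  rw [vpModular_eq, vpModular_eq, ← ENNReal.tsum_mul_left]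
  refine ENNReal.tsum_le_tsum fun k => ?_
  have hm := vpMean_nonneg hlam x k
  have hpk : 0 ≤ pp (k + 1) := (zero_lt_one.trans (hp _ (Nat.le_add_left 1 k))).le
  rw [← ENNReal.ofReal_mul (by positivity), vpMean_smul, abs_of_nonneg hc,
    Real.mul_rpow hc hm]
  refine ENNReal.ofReal_le_ofReal (mul_le_mul_of_nonneg_right ?_ (Real.rpow_nonneg hm _))
  exact (Real.rpow_le_rpow hc hcd hpk).trans (Real.rpow_le_rpow_of_exponent_le hd (hH k))

lemma luxNorm_nonneg (x : ℕ → ℝ) : 0 ≤ luxNorm lam pp x :=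
  Real.sInf_nonneg fun _ ht => ht.1.le

lemma luxNorm_le {t : ℝ} {x : ℕ → ℝ} (ht : 0 < t) (h : vpModular lam pp (t⁻¹ • x) ≤ 1) :
    luxNorm lam pp x ≤ t :=
  csInf_le ⟨0, fun _ hs => hs.1.le⟩ ⟨ht, h⟩

lemma vpModular_le_one (hlam : ∀ k : ℕ, 1 ≤ k → 0 < lam k) (hp : ∀ k : ℕ, 1 ≤ k → 1 < pp k)
    (hH : ∀ k, pp (k + 1) ≤ H) {x : ℕ → ℝ} (hx0 : 0 < luxNorm lam pp x)
    (hx1 : luxNorm lam pp x ≤ 1) : vpModular lam pp x ≤ 1 := by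
  have key : ∀ t : ℝ, 1 < t → vpModular lam pp x ≤ ENNReal.ofReal (t ^ H) := by
    intro t ht
    have hne : {t : ℝ | 0 < t ∧ vpModular lam pp (t⁻¹ • x) ≤ 1}.Nonempty := by
      by_contra hcon
      rw [luxNorm, Set.not_nonempty_iff_eq_empty.1 hcon, Real.sInf_empty] at hx0
      exact lt_irrefl _ hx0
    obtain ⟨s, ⟨hs0, hs1⟩, hst⟩ := exists_lt_of_csInf_lt hne (hx1.trans_lt ht)
    have h := vpModular_smul_le hlam hp hH hs0.le hst.le ht.le (s⁻¹ • x)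
    rw [smul_inv_smul₀ hs0.ne'] at h
    exact h.trans (mul_le_of_le_one_right' hs1)
  have hlim : Tendsto (fun t : ℝ => ENNReal.ofReal (t ^ H)) (nhdsWithin 1 (Set.Ioi 1))
      (nhds 1) := by
    have h : ContinuousAt (fun t : ℝ => ENNReal.ofReal (t ^ H)) 1 :=
      ENNReal.continuous_ofReal.continuousAt.comp
        (Real.continuousAt_rpow_const 1 H (Or.inl one_ne_zero))
    have h' := h.tendsto
    simp only [Real.one_rpow, ENNReal.ofReal_one] at h'
    exact h'.mono_left nhdsWithin_le_nhds
  exact ge_of_tendsto hlim (eventually_nhdsWithin_of_forall key)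

lemma ofReal_luxNorm_rpow_le (hlam : ∀ k : ℕ, 1 ≤ k → 0 < lam k)
    (hp : ∀ k : ℕ, 1 ≤ k → 1 < pp k) (hH : ∀ k, pp (k + 1) ≤ H) {x : ℕ → ℝ}
    (hx0 : 0 < luxNorm lam pp x) (hx1 : luxNorm lam pp x ≤ 1) :
    ENNReal.ofReal (luxNorm lam pp x ^ H) ≤ vpModular lam pp x := by
  have key : ∀ t ∈ Set.Ioo 0 (luxNorm lam pp x),
      ENNReal.ofReal (t ^ H) ≤ vpModular lam pp x := by
    rintro t ⟨ht0, ht⟩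
    have h1 : 1 < vpModular lam pp (t⁻¹ • x) :=
      not_le.1 fun h => ht.not_ge (luxNorm_le ht0 h)
    have h2 := h1.le.trans (vpModular_smul_le hlam hp hH (inv_nonneg.2 ht0.le) le_rfl
      ((one_le_inv₀ ht0).2 (ht.le.trans hx1)) x)
    calc ENNReal.ofReal (t ^ H) = ENNReal.ofReal (t ^ H) * 1 := (mul_one _).symm
      _ ≤ ENNReal.ofReal (t ^ H) * (ENNReal.ofReal (t⁻¹ ^ H) * vpModular lam pp x) := by gcongr
      _ = vpModular lam pp x := by
        rw [← mul_assoc, ← ENNReal.ofReal_mul (by positivity),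
          ← Real.mul_rpow ht0.le (inv_nonneg.2 ht0.le), mul_inv_cancel₀ ht0.ne']
        simp
  have hlim : Tendsto (fun t : ℝ => ENNReal.ofReal (t ^ H))
      (nhdsWithin (luxNorm lam pp x) (Set.Iio (luxNorm lam pp x)))
      (nhds (ENNReal.ofReal (luxNorm lam pp x ^ H))) :=
    (ENNReal.continuous_ofReal.continuousAt.comp
      (Real.continuousAt_rpow_const _ H (Or.inl hx0.ne'))).tendsto.mono_left nhdsWithin_le_nhds
  refine le_of_tendsto hlim ?_
  filter_upwards [Ioo_mem_nhdsLT hx0] with t ht using key t ht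

lemma tendsto_vpModular_one (hlam : ∀ k : ℕ, 1 ≤ k → 0 < lam k)
    (hp : ∀ k : ℕ, 1 ≤ k → 1 < pp k) (hH : ∀ k, pp (k + 1) ≤ H) {xs : ℕ → ℕ → ℝ}
    (hxs : ∀ n, luxNorm lam pp (xs n) ≤ 1)
    (hnorm : Tendsto (fun n => luxNorm lam pp (xs n)) atTop (nhds 1)) :
    Tendsto (fun n => vpModular lam pp (xs n)) atTop (nhds 1) := by
  have hlow : Tendsto (fun n => ENNReal.ofReal (luxNorm lam pp (xs n) ^ H)) atTop (nhds 1) := by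
    simpa using ENNReal.tendsto_ofReal (hnorm.rpow_const (p := H) (Or.inl one_ne_zero))
  have hpos := hnorm.eventually_const_lt zero_lt_one
  refine tendsto_of_tendsto_of_tendsto_of_le_of_le' hlow tendsto_const_nhds ?_ ?_
  · filter_upwards [hpos] with n hn using ofReal_luxNorm_rpow_le hlam hp hH hn (hxs n)
  · filter_upwards [hpos] with n hn using vpModular_le_one hlam hp hH hn (hxs n)

lemma tendsto_vpModular_sub (hlam : ∀ k : ℕ, 1 ≤ k → 0 < lam k)
    (hp : ∀ k : ℕ, 1 ≤ k → 1 < pp k) (hH : ∀ k, pp (k + 1) ≤ H)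
    {xs : ℕ → ℕ → ℝ} {x : ℕ → ℝ} (hx : vpModular lam pp x ≠ ⊤)
    (hmod : Tendsto (fun n => vpModular lam pp (xs n)) atTop (nhds (vpModular lam pp x)))
    (hcoord : ∀ j : ℕ, 1 ≤ j → Tendsto (fun n => xs n j) atTop (nhds (x j))) :
    Tendsto (fun n => vpModular lam pp (xs n - x)) atTop (nhds 0) := by
  have hpk : ∀ k, 0 < pp (k + 1) := fun k => zero_lt_one.trans (hp _ (Nat.le_add_left 1 k))
  refine ENNReal.tendsto_tsum_zero_of_le_mul_add (C := ENNReal.ofReal (2 ^ H))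
    (f := fun n k => ENNReal.ofReal (vpMean lam (xs n) (k + 1) ^ pp (k + 1)))
    (h := fun n k => ENNReal.ofReal (vpMean lam (xs n - x) (k + 1) ^ pp (k + 1)))
    ENNReal.ofReal_ne_top hx (fun n k => ?_) (fun k => ?_) (fun k => ?_) hmod
  · have h1 := vpMean_nonneg hlam (xs n) k
    have h2 := vpMean_nonneg hlam x k
    refine (ENNReal.ofReal_le_ofReal <|
      (Real.rpow_le_rpow (vpMean_nonneg hlam _ k) (vpMean_sub_le hlam (xs n) x k)
        (hpk k).le).trans (Real.add_rpow_le_two_rpow_mul_add h1 h2 (hpk k).le (hH k))).trans_eq ?_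
    rw [ENNReal.ofReal_mul (by positivity)]
    exact congrArg _ (ENNReal.ofReal_add (Real.rpow_nonneg h1 _) (Real.rpow_nonneg h2 _))
  · exact ENNReal.tendsto_ofReal ((tendsto_vpMean hcoord (k + 1)).rpow_const (Or.inr (hpk k).le))
  · have h : Tendsto (fun n => vpMean lam (xs n - x) (k + 1)) atTop
        (nhds (vpMean lam 0 (k + 1))) :=
      tendsto_vpMean (fun j hj => by simpa using (hcoord j hj).sub_const (x j)) (k + 1)
    have h0 : vpMean lam 0 (k + 1) = 0 := by simp [vpMean]
    rw [h0] at h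
    simpa [Real.zero_rpow (hpk k).ne'] using
      ENNReal.tendsto_ofReal (h.rpow_const (p := pp (k + 1)) (Or.inr (hpk k).le))

lemma tendsto_luxNorm_zero (hlam : ∀ k : ℕ, 1 ≤ k → 0 < lam k)
    (hp : ∀ k : ℕ, 1 ≤ k → 1 < pp k) (hH : ∀ k, pp (k + 1) ≤ H) {ys : ℕ → ℕ → ℝ}
    (hys : Tendsto (fun n => vpModular lam pp (ys n)) atTop (nhds 0)) :
    Tendsto (fun n => luxNorm lam pp (ys n)) atTop (nhds 0) := by
  refine tendsto_order.2 ⟨fun a ha => Eventually.of_forall fun n =>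
    ha.trans_le (luxNorm_nonneg _), fun ε hε => ?_⟩
  obtain ⟨t, ht0, ht⟩ := exists_between (lt_min hε zero_lt_one)
  have hlim : Tendsto (fun n => ENNReal.ofReal (t⁻¹ ^ H) * vpModular lam pp (ys n)) atTop
      (nhds 0) := by
    simpa using ENNReal.Tendsto.const_mul hys (Or.inr (ENNReal.ofReal_ne_top (r := t⁻¹ ^ H)))
  filter_upwards [hlim.eventually_lt_const zero_lt_one] with n hn
  refine (luxNorm_le ht0 ?_).trans_lt (ht.trans_le (min_le_left _ _))
  exact (vpModular_smul_le hlam hp hH (inv_nonneg.2 ht0.le) le_rfl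
    ((one_le_inv₀ ht0).2 (ht.le.trans (min_le_right _ _))) _).trans hn.le

end Modular

/-- The Kadec–Klee property of `V_ρ(λ;p)`, with weak convergence witnessed by
coordinatewise convergence. -/
theorem vrho_kadecKlee (lam pp : ℕ → ℝ)
    (hlam1 : lam 1 = 1)
    (hlam_pos : ∀ k : ℕ, 1 ≤ k → 0 < lam k)
    (hlam_mono : ∀ k : ℕ, 1 ≤ k → lam k ≤ lam (k + 1))
    (hlam_step : ∀ k : ℕ, 1 ≤ k → lam (k + 1) ≤ lam k + 1)
    (hlam_top : Tendsto lam atTop atTop)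
    (hp_gt : ∀ k : ℕ, 1 ≤ k → 1 < pp k)
    (hp_bdd : BddAbove (Set.range fun k : ℕ => pp (k + 1)))
    (x : ℕ → ℝ) (hx : memVrho lam pp x) (hxS : luxNorm lam pp x = 1)
    (xs : ℕ → ℕ → ℝ) (hxs : ∀ n, memVrho lam pp (xs n))
    (hxsB : ∀ n, luxNorm lam pp (xs n) ≤ 1)
    (hnorm : Tendsto (fun n => luxNorm lam pp (xs n)) atTop (nhds 1))
    (hcoord : ∀ j : ℕ, 1 ≤ j →
      Tendsto (fun n => xs n j) atTop (nhds (x j))) :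
    Tendsto (fun n => luxNorm lam pp (xs n - x)) atTop (nhds 0) := by
  obtain ⟨H, hH'⟩ := hp_bdd
  have hH : ∀ k, pp (k + 1) ≤ H := fun k => hH' ⟨k, rfl⟩
  have hρx : vpModular lam pp x = 1 :=
    tendsto_nhds_unique tendsto_const_nhds
      (tendsto_vpModular_one (xs := fun _ => x) hlam_pos hp_gt hH (fun _ => hxS.le)
        (by simp only [hxS, tendsto_const_nhds]))
  refine tendsto_luxNorm_zero hlam_pos hp_gt hH
    (tendsto_vpModular_sub hlam_pos hp_gt hH (by simp [hρx]) ?_ hcoord)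
  rw [hρx]
  exact tendsto_vpModular_one hlam_pos hp_gt hH hxsB hnorm
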